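/- If p ≥ q, a ∈ ℝ^p, b ∈ ℝ^q are positive vectors satisfying e_p(a)/e_q(b) ≤ e_{p−1}(a)/e_{q−1}(b) ≤ … ≤ e_{p−q+1}(a)/e_1(b) ≤ e_{p−q}(a), then x ↦ pFq(a; b; x) is log-convex on (0,1) (and for p = q on (0,∞)); equivalently the Laguerre expression [pFq']² − pFq · pFq'' is ≤ 0 there. -/

import Mathlib

open Finset

/-- The `m`-th elementary symmetric polynomial of `a 0, …, a (p-1)`. -/
noncomputable def esymm (p : ℕ) (a : ℕ → ℝ) (m : ℕ) : ℝ :=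
  ∑ s ∈ (Finset.range p).powersetCard m, ∏ i ∈ s, a i

/-- The generalized hypergeometric function `pFq(a; b; x)`. -/
noncomputable def pFq (p q : ℕ) (a b : ℕ → ℝ) (x : ℝ) : ℝ :=
  ∑' n : ℕ, (∏ i ∈ Finset.range p, (ascPochhammer ℝ n).eval (a i)) /
      ((∏ j ∈ Finset.range q, (ascPochhammer ℝ n).eval (b j)) * n.factorial) * x ^ n

/-- The exponential generating function of the sequence `g`. -/
noncomputable def expGenFun (g : ℕ → ℝ) (x : ℝ) : ℝ := ∑' n : ℕ, g n / n.factorial * x ^ n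

section ExpGenFun

open Topology

variable {g : ℕ → ℝ}

theorem summable_expGenFun_of_abs_le (hg : ∀ n, 0 < g n) {r x : ℝ}
    (hr : Summable fun n : ℕ => g n / n.factorial * r ^ n) (hx : |x| ≤ r) :
    Summable fun n : ℕ => g n / n.factorial * x ^ n := by
  refine Summable.of_norm_bounded hr fun n => ?_
  have h : 0 < g n / n.factorial := div_pos (hg n) (by positivity)
  rw [norm_mul, norm_pow, Real.norm_of_nonneg h.le, Real.norm_eq_abs]
  gcongr

theorem hasDerivAt_expGenFun (hg : ∀ n, 0 < g n) {r x : ℝ}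
    (h₀ : Summable fun n : ℕ => g n / n.factorial * r ^ n)
    (h₁ : Summable fun n : ℕ => g (n + 1) / n.factorial * r ^ n) (hx : |x| < r) :
    HasDerivAt (expGenFun g) (expGenFun (fun n => g (n + 1)) x) x := by
  have hterm : ∀ (n : ℕ) (y : ℝ), g (n + 1) / (n + 1).factorial * (((n + 1 : ℕ) : ℝ) * y ^ n) =
      g (n + 1) / n.factorial * y ^ n := by
    intro n y
    rw [Nat.factorial_succ]
    push_cast
    field_simp
  have hu : Summable fun n : ℕ => g n / n.factorial * (n * r ^ (n - 1)) := by
    rw [← summable_nat_add_iff 1]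
    refine h₁.congr fun n => ?_
    rw [Nat.add_sub_cancel, hterm]
  have hx0 : 0 < r := (abs_nonneg x).trans_lt hx
  have key := hasDerivAt_tsum_of_isPreconnected (𝕜 := ℝ) (F := ℝ)
    (g := fun n y => g n / n.factorial * y ^ n)
    (g' := fun n y => g n / n.factorial * (n * y ^ (n - 1)))
    (t := Metric.ball (0 : ℝ) r) (y₀ := 0) (y := x) hu Metric.isOpen_ball
    (convex_ball (0 : ℝ) r).isPreconnected
    (fun n y _ => (hasDerivAt_pow n y).const_mul _) ?_ (by simpa using hx0)
    (summable_expGenFun_of_abs_le hg h₀ (by simpa using hx0.le)) (by simpa using hx)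
  · have hs : Summable fun n : ℕ => g n / n.factorial * (n * x ^ (n - 1)) := by
      rw [← summable_nat_add_iff 1]
      refine (summable_expGenFun_of_abs_le (fun n => hg (n + 1)) h₁ hx.le).congr fun n => ?_
      rw [Nat.add_sub_cancel, hterm]
    have hval : ∑' n : ℕ, g n / n.factorial * (n * x ^ (n - 1)) =
        expGenFun (fun n => g (n + 1)) x := by
      rw [hs.tsum_eq_zero_add, expGenFun]
      simp only [Nat.cast_zero, zero_mul, mul_zero, zero_add, Nat.add_sub_cancel, hterm]
    rw [← hval]
    exact key
  · intro n y hy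
    have hy' : |y| ≤ r := by simpa using (mem_ball_zero_iff.1 hy).le
    have h : 0 < g n / n.factorial := div_pos (hg n) (by positivity)
    rw [norm_mul, norm_mul, norm_pow, Real.norm_of_nonneg h.le, Real.norm_natCast,
      Real.norm_eq_abs]
    gcongr

theorem expGenFun_pos (hg : ∀ n, 0 < g n) {x : ℝ} (hx : 0 ≤ x)
    (h : Summable fun n : ℕ => g n / n.factorial * x ^ n) : 0 < expGenFun g x :=
  h.tsum_pos (fun n => mul_nonneg (div_pos (hg n) (by positivity)).le (pow_nonneg hx n)) 0
    (by simpa using hg 0)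

theorem expGenFun_shift_sq_le (hg : ∀ n, 0 < g n)
    (hlog : ∀ n, g (n + 1) ^ 2 ≤ g n * g (n + 2)) {x : ℝ} (hx : 0 ≤ x)
    (h : ∀ k, Summable fun n : ℕ => g (n + k) / n.factorial * x ^ n) :
    expGenFun (fun n => g (n + 1)) x ^ 2 ≤
      expGenFun g x * expGenFun (fun n => g (n + 2)) x := by
  have key : ∀ t : ℝ, 0 ≤ expGenFun g x * (t * t) +
      (2 * expGenFun (fun n => g (n + 1)) x) * t + expGenFun (fun n => g (n + 2)) x := by
    intro t
    have hsum := (((h 0).hasSum.mul_right (t * t)).add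
      (((h 1).hasSum.mul_left 2).mul_right t)).add (h 2).hasSum
    refine hsum.nonneg fun n => ?_
    have hn : 0 ≤ x ^ n / n.factorial := by positivity
    have hquad : 0 ≤ g n * (t * t) + 2 * g (n + 1) * t + g (n + 2) := by
      have h1 := hg n
      have h2 : 0 ≤ g n * (g n * (t * t) + 2 * g (n + 1) * t + g (n + 2)) := by
        nlinarith [hlog n, sq_nonneg (g n * t + g (n + 1))]
      exact nonneg_of_mul_nonneg_right h2 h1
    calc 0 ≤ (g n * (t * t) + 2 * g (n + 1) * t + g (n + 2)) * (x ^ n / n.factorial) :=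
          mul_nonneg hquad hn
      _ = _ := by simp only [Nat.add_zero]; ring
  have := discrim_le_zero key
  rw [discrim] at this
  linarith

/-- An exponential generating function with positive log-convex coefficients is log-convex. -/
theorem logConvex_expGenFun (hg : ∀ n, 0 < g n)
    (hlog : ∀ n, g (n + 1) ^ 2 ≤ g n * g (n + 2)) {U : Set ℝ} (hUo : IsOpen U)
    (hUc : Convex ℝ U) (hU : ∀ x ∈ U, 0 < x ∧
      ∃ r > x, ∀ k, Summable fun n : ℕ => g (n + k) / n.factorial * r ^ n) :
    ConvexOn ℝ U (fun x => Real.log (expGenFun g x)) ∧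
      ∀ x ∈ U, deriv (expGenFun g) x ^ 2 ≤ expGenFun g x * deriv (deriv (expGenFun g)) x := by
  have hsum : ∀ x ∈ U, ∀ k, Summable fun n : ℕ => g (n + k) / n.factorial * x ^ n := by
    intro x hx k
    obtain ⟨hx0, r, hr, hs⟩ := hU x hx
    exact summable_expGenFun_of_abs_le (fun n => hg (n + k)) (hs k)
      (by rw [abs_of_pos hx0]; exact hr.le)
  have hpos : ∀ x ∈ U, 0 < expGenFun g x := fun x hx =>
    expGenFun_pos hg (hU x hx).1.le (hsum x hx 0)
  have hsq : ∀ x ∈ U, _ := fun x hx => expGenFun_shift_sq_le hg hlog (hU x hx).1.le (hsum x hx)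
  have hd₁ : ∀ x ∈ U, HasDerivAt (expGenFun g) (expGenFun (fun n => g (n + 1)) x) x := by
    intro x hx
    obtain ⟨hx0, r, hr, hs⟩ := hU x hx
    exact hasDerivAt_expGenFun hg (hs 0) (hs 1) (by rwa [abs_of_pos hx0])
  have hd₂ : ∀ x ∈ U, HasDerivAt (expGenFun fun n => g (n + 1))
      (expGenFun (fun n => g (n + 2)) x) x := by
    intro x hx
    obtain ⟨hx0, r, hr, hs⟩ := hU x hx
    exact hasDerivAt_expGenFun (fun n => hg (n + 1)) (hs 1) (hs 2) (by rwa [abs_of_pos hx0])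
  refine ⟨?_, fun x hx => ?_⟩
  · refine convexOn_of_hasDerivWithinAt2_nonneg hUc
      (f' := fun x => expGenFun (fun n => g (n + 1)) x / expGenFun g x)
      (f'' := fun x => (expGenFun (fun n => g (n + 2)) x * expGenFun g x -
        expGenFun (fun n => g (n + 1)) x * expGenFun (fun n => g (n + 1)) x) / expGenFun g x ^ 2)
      (fun x hx => ((hd₁ x hx).log (hpos x hx).ne').continuousAt.continuousWithinAt) ?_ ?_ ?_
    all_goals rw [hUo.interior_eq]; intro x hx
    · exact ((hd₁ x hx).log (hpos x hx).ne').hasDerivWithinAt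
    · exact ((hd₂ x hx).div (hd₁ x hx) (hpos x hx).ne').hasDerivWithinAt
    · exact div_nonneg (by linarith [hsq x hx]) (sq_nonneg _)
  · have hev : deriv (expGenFun g) =ᶠ[𝓝 x] expGenFun fun n => g (n + 1) := by
      filter_upwards [hUo.mem_nhds hx] with y hy using (hd₁ y hy).deriv
    rw [hev.deriv_eq, (hd₂ x hx).deriv, (hd₁ x hx).deriv]
    exact hsq x hx

end ExpGenFun

section RationalMonotone

theorem sum_mul_pow_mul_sum_mul_pow_le {N : ℕ} {α β : ℕ → ℝ}
    (h : ∀ k l, k ≤ l → l < N → α k * β l ≤ α l * β k) {x y : ℝ} (hx : 0 ≤ x) (hxy : x ≤ y) :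
    (∑ k ∈ range N, α k * x ^ k) * ∑ k ∈ range N, β k * y ^ k ≤
      (∑ k ∈ range N, α k * y ^ k) * ∑ k ∈ range N, β k * x ^ k := by
  have hpow : ∀ k l, k ≤ l → x ^ l * y ^ k ≤ x ^ k * y ^ l := by
    intro k l hkl
    obtain ⟨m, rfl⟩ := Nat.exists_eq_add_of_le hkl
    have h1 : x ^ m ≤ y ^ m := pow_le_pow_left₀ hx hxy m
    have h2 : 0 ≤ x ^ k * y ^ k := mul_nonneg (pow_nonneg hx k) (pow_nonneg (hx.trans hxy) k)
    rw [pow_add, pow_add]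
    nlinarith
  have hterm : ∀ k ∈ range N, ∀ l ∈ range N,
      0 ≤ (α l * β k - α k * β l) * (x ^ k * y ^ l - x ^ l * y ^ k) := by
    intro k hk l hl
    rcases le_total k l with hkl | hkl
    · exact mul_nonneg (sub_nonneg.2 (h k l hkl (mem_range.1 hl))) (sub_nonneg.2 (hpow k l hkl))
    · exact mul_nonneg_of_nonpos_of_nonpos (sub_nonpos.2 (h l k hkl (mem_range.1 hk)))
        (sub_nonpos.2 (hpow l k hkl))
  have hsum := sum_nonneg fun k hk => sum_nonneg (hterm k hk)
  have hexp : ∑ k ∈ range N, ∑ l ∈ range N,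
      (α l * β k - α k * β l) * (x ^ k * y ^ l - x ^ l * y ^ k) =
      2 * ((∑ k ∈ range N, α k * y ^ k) * ∑ k ∈ range N, β k * x ^ k) -
      2 * ((∑ k ∈ range N, α k * x ^ k) * ∑ k ∈ range N, β k * y ^ k) := by
    have e1 : (∑ k ∈ range N, α k * y ^ k) * ∑ k ∈ range N, β k * x ^ k =
        ∑ k ∈ range N, ∑ l ∈ range N, α k * y ^ k * (β l * x ^ l) := sum_mul_sum ..
    have e2 : (∑ k ∈ range N, α k * x ^ k) * ∑ k ∈ range N, β k * y ^ k =
        ∑ k ∈ range N, ∑ l ∈ range N, α k * x ^ k * (β l * y ^ l) := sum_mul_sum ..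
    have e1' := e1.trans sum_comm
    have e2' := e2.trans sum_comm
    rw [two_mul, two_mul]
    nth_rewrite 1 [e1]
    rw [e1']
    nth_rewrite 1 [e2]
    rw [e2']
    simp only [← sum_add_distrib, ← sum_sub_distrib]
    refine sum_congr rfl fun k _ => sum_congr rfl fun l _ => ?_
    ring
  linarith

theorem prod_add_eq_sum_esymm (p : ℕ) (a : ℕ → ℝ) (x : ℝ) :
    ∏ i ∈ range p, (a i + x) = ∑ k ∈ range (p + 1), esymm p a (p - k) * x ^ k := by
  rw [prod_add, sum_powerset, card_range, ← sum_range_reflect]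
  refine sum_congr rfl fun k hk => ?_
  rw [esymm, sum_mul, Nat.add_sub_cancel]
  refine sum_congr rfl fun t ht => ?_
  obtain ⟨hts, htc⟩ := mem_powersetCard.1 ht
  have hk' : k ≤ p := Nat.lt_succ_iff.1 (mem_range.1 hk)
  rw [prod_const, card_sdiff_of_subset hts, htc, card_range, Nat.sub_sub_self hk']

theorem esymm_pos {p : ℕ} {a : ℕ → ℝ} (ha : ∀ i < p, 0 < a i) {m : ℕ} (hm : m ≤ p) :
    0 < esymm p a m := by
  refine sum_pos (fun s hs => prod_pos fun i hi => ?_) (powersetCard_nonempty.2 (by simpa using hm))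
  exact ha i (mem_range.1 ((mem_powersetCard.1 hs).1 hi))

theorem prod_add_mul_prod_add_le {p q : ℕ} (hpq : q ≤ p) {a b : ℕ → ℝ}
    (ha : ∀ i < p, 0 < a i) (hb : ∀ j < q, 0 < b j)
    (hchain : ∀ j, 1 ≤ j → j ≤ q →
      esymm p a (p - q + j) / esymm q b j ≤ esymm p a (p - q + j - 1) / esymm q b (j - 1))
    {x y : ℝ} (hx : 0 ≤ x) (hxy : x ≤ y) :
    (∏ i ∈ range p, (a i + x)) * ∏ j ∈ range q, (b j + y) ≤
      (∏ i ∈ range p, (a i + y)) * ∏ j ∈ range q, (b j + x) := by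
  set β : ℕ → ℝ := fun k => if k ≤ q then esymm q b (q - k) else 0 with hβ
  have hB : ∀ z : ℝ, ∏ j ∈ range q, (b j + z) = ∑ k ∈ range (p + 1), β k * z ^ k := by
    intro z
    rw [prod_add_eq_sum_esymm]
    refine sum_congr_of_eq_on_inter ?_ ?_ ?_
    · intro k hk hk'
      simp only [mem_range] at hk hk'
      omega
    · intro k _ hk'
      have : ¬ k ≤ q := by simpa [Nat.lt_succ_iff] using hk'
      simp [hβ, this]
    · intro k hk _
      have : k ≤ q := by simpa [Nat.lt_succ_iff] using hk
      simp [hβ, this]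
  rw [hB, hB, prod_add_eq_sum_esymm, prod_add_eq_sum_esymm]
  refine sum_mul_pow_mul_sum_mul_pow_le (fun k l hkl hl => ?_) hx hxy
  by_cases hlq : l ≤ q
  · have hmono : ∀ l, k ≤ l → l ≤ q →
        esymm p a (p - k) / esymm q b (q - k) ≤ esymm p a (p - l) / esymm q b (q - l) := by
      intro l hkl
      induction l, hkl using Nat.le_induction with
      | base => exact fun _ => le_rfl
      | succ m hkm ih =>
        intro hm
        refine (ih (by omega)).trans ?_
        have h := hchain (q - m) (by omega) (by omega)
        rwa [show p - q + (q - m) - 1 = p - (m + 1) by omega,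
          show p - q + (q - m) = p - m by omega, show q - m - 1 = q - (m + 1) by omega] at h
    have h := hmono l hkl hlq
    rw [div_le_div_iff₀ (esymm_pos hb (Nat.sub_le _ _)) (esymm_pos hb (Nat.sub_le _ _))] at h
    simpa [hβ, hlq, hkl.trans hlq] using h
  · have h0 : 0 ≤ β k := by
      simp only [hβ]
      split_ifs
      · exact (esymm_pos hb (Nat.sub_le _ _)).le
      · exact le_rfl
    have h1 := mul_nonneg (esymm_pos ha (Nat.sub_le p l)).le h0
    simpa [hβ, hlq] using h1

end RationalMonotone

section Coefficients

open Filter Topology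

theorem summable_shift_of_tendsto_ratio {g : ℕ → ℝ} (hg : ∀ n, 0 < g n) {L r : ℝ}
    (hL : Tendsto (fun n : ℕ => g (n + 1) / g n / ((n : ℝ) + 1)) atTop (𝓝 L))
    (hr : 0 < r) (hLr : L * r < 1) (k : ℕ) :
    Summable fun n : ℕ => g (n + k) / n.factorial * r ^ n := by
  have hpos : ∀ n, 0 < g (n + k) / n.factorial * r ^ n := fun n =>
    mul_pos (div_pos (hg _) (by positivity)) (pow_pos hr n)
  refine summable_of_ratio_test_tendsto_lt_one hLr (Eventually.of_forall fun n => (hpos n).ne') ?_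
  have h1 : Tendsto (fun n : ℕ => ((k : ℝ) + 1 + 1 * n) / (1 + 1 * n)) atTop (𝓝 (1 / 1)) :=
    tendsto_add_mul_div_add_mul_atTop_nhds _ _ _ one_ne_zero
  have h2 := (((tendsto_add_atTop_iff_nat k).2 hL).mul h1).mul_const r
  rw [div_one, mul_one] at h2
  refine h2.congr fun n => ?_
  rw [Real.norm_of_nonneg (hpos _).le, Real.norm_of_nonneg (hpos _).le, Nat.factorial_succ,
    show n + 1 + k = n + k + 1 by ring]
  have := (hg (n + k)).ne'
  have h3 : (n : ℝ) + k + 1 ≠ 0 := by positivity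
  have h4 : (k : ℝ) + 1 + n ≠ 0 := by positivity
  have h5 : (1 : ℝ) + n ≠ 0 := by positivity
  push_cast
  field_simp
  ring

/-- The coefficient of `x ^ n / n!` in the hypergeometric series. -/
noncomputable def hypergeometricCoeff (p q : ℕ) (a b : ℕ → ℝ) (n : ℕ) : ℝ :=
  (∏ i ∈ range p, (ascPochhammer ℝ n).eval (a i)) /
    ∏ j ∈ range q, (ascPochhammer ℝ n).eval (b j)

theorem pFq_eq_expGenFun (p q : ℕ) (a b : ℕ → ℝ) :
    pFq p q a b = expGenFun (hypergeometricCoeff p q a b) := by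
  funext x
  simp only [pFq, expGenFun, hypergeometricCoeff, div_div]

variable {p q : ℕ} {a b : ℕ → ℝ}

theorem hypergeometricCoeff_pos (ha : ∀ i < p, 0 < a i) (hb : ∀ j < q, 0 < b j) (n : ℕ) :
    0 < hypergeometricCoeff p q a b n :=
  div_pos (prod_pos fun i hi => ascPochhammer_pos n _ (ha i (mem_range.1 hi)))
    (prod_pos fun j hj => ascPochhammer_pos n _ (hb j (mem_range.1 hj)))

theorem hypergeometricCoeff_succ (p q : ℕ) (a b : ℕ → ℝ) (n : ℕ) :
    hypergeometricCoeff p q a b (n + 1) = hypergeometricCoeff p q a b n *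
      ((∏ i ∈ range p, (a i + n)) / ∏ j ∈ range q, (b j + n)) := by
  simp only [hypergeometricCoeff, ascPochhammer_succ_eval, prod_mul_distrib, mul_div_mul_comm]

theorem prod_add_natCast_pos {m : ℕ} {c : ℕ → ℝ} (hc : ∀ i < m, 0 < c i) (n : ℕ) :
    0 < ∏ i ∈ range m, (c i + n) :=
  prod_pos fun i hi => add_pos_of_pos_of_nonneg (hc i (mem_range.1 hi)) n.cast_nonneg

theorem hypergeometricCoeff_sq_le (hpq : q ≤ p) (ha : ∀ i < p, 0 < a i) (hb : ∀ j < q, 0 < b j)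
    (hchain : ∀ j, 1 ≤ j → j ≤ q →
      esymm p a (p - q + j) / esymm q b j ≤ esymm p a (p - q + j - 1) / esymm q b (j - 1))
    (n : ℕ) :
    hypergeometricCoeff p q a b (n + 1) ^ 2 ≤
      hypergeometricCoeff p q a b n * hypergeometricCoeff p q a b (n + 2) := by
  have hratio : (∏ i ∈ range p, (a i + n)) / ∏ j ∈ range q, (b j + n) ≤
      (∏ i ∈ range p, (a i + (n + 1 : ℕ))) / ∏ j ∈ range q, (b j + (n + 1 : ℕ)) := by
    rw [div_le_div_iff₀ (prod_add_natCast_pos hb _) (prod_add_natCast_pos hb _)]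
    exact prod_add_mul_prod_add_le hpq ha hb hchain n.cast_nonneg (by simp)
  calc hypergeometricCoeff p q a b (n + 1) ^ 2
      = hypergeometricCoeff p q a b n * (hypergeometricCoeff p q a b (n + 1) *
          ((∏ i ∈ range p, (a i + n)) / ∏ j ∈ range q, (b j + n))) := by
        rw [hypergeometricCoeff_succ]; ring
    _ ≤ _ := by
        rw [hypergeometricCoeff_succ p q a b (n + 1)]
        gcongr
        · exact (hypergeometricCoeff_pos ha hb n).le
        · exact (hypergeometricCoeff_pos ha hb (n + 1)).le

theorem hypergeometricCoeff_ratio (d : ℕ) (ha : ∀ i < q + d, 0 < a i) (hb : ∀ j < q, 0 < b j)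
    (n : ℕ) :
    hypergeometricCoeff (q + d) q a b (n + 1) / hypergeometricCoeff (q + d) q a b n /
        ((n : ℝ) + 1) =
      (∏ i ∈ range q, ((a i + 1 * n) / (b i + 1 * n))) *
        ((∏ i ∈ range d, (a (q + i) + n)) / ((n : ℝ) + 1)) := by
  rw [hypergeometricCoeff_succ, mul_div_cancel_left₀ _ (hypergeometricCoeff_pos ha hb n).ne',
    prod_range_add, prod_div_distrib]
  simp only [one_mul]
  ring

theorem tendsto_prod_add_div_add (q : ℕ) (a b : ℕ → ℝ) :
    Tendsto (fun n : ℕ => ∏ i ∈ range q, ((a i + 1 * n) / (b i + 1 * n))) atTop (𝓝 1) := by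
  have h := tendsto_finsetProd (range q) fun i _ =>
    tendsto_add_mul_div_add_mul_atTop_nhds (a i) (b i) (1 : ℝ) one_ne_zero
  simpa using h

theorem tendsto_prod_add_natCast_atTop (d : ℕ) (c : ℕ → ℝ) :
    Tendsto (fun n : ℕ => ∏ i ∈ range (d + 1), (c i + (n : ℝ))) atTop atTop := by
  have h : ∀ i, Tendsto (fun n : ℕ => c i + (n : ℝ)) atTop atTop := fun i =>
    tendsto_atTop_add_const_left _ _ tendsto_natCast_atTop_atTop
  induction d with
  | zero => simpa using h 0
  | succ d ih =>
    simp only [prod_range_succ _ (d + 1)]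
    exact ih.atTop_mul_atTop₀ (h _)

theorem tendsto_add_natCast_div (c : ℝ) :
    Tendsto (fun n : ℕ => (c + (n : ℝ)) / ((n : ℝ) + 1)) atTop (𝓝 1) := by
  have h := tendsto_add_mul_div_add_mul_atTop_nhds c 1 (1 : ℝ) one_ne_zero
  simpa [add_comm] using h

theorem tendsto_hypergeometricCoeff_ratio_zero (ha : ∀ i < q, 0 < a i) (hb : ∀ j < q, 0 < b j) :
    Tendsto (fun n : ℕ => hypergeometricCoeff q q a b (n + 1) / hypergeometricCoeff q q a b n /
      ((n : ℝ) + 1)) atTop (𝓝 0) := by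
  have h := (tendsto_prod_add_div_add q a b).mul (tendsto_one_div_add_atTop_nhds_zero_nat (𝕜 := ℝ))
  rw [mul_zero] at h
  refine h.congr fun n => ?_
  simpa using (hypergeometricCoeff_ratio 0 ha hb n).symm

theorem tendsto_hypergeometricCoeff_ratio_one (ha : ∀ i < q + 1, 0 < a i)
    (hb : ∀ j < q, 0 < b j) :
    Tendsto (fun n : ℕ => hypergeometricCoeff (q + 1) q a b (n + 1) /
      hypergeometricCoeff (q + 1) q a b n / ((n : ℝ) + 1)) atTop (𝓝 1) := by
  have h := (tendsto_prod_add_div_add q a b).mul (tendsto_add_natCast_div (a q))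
  rw [mul_one] at h
  refine h.congr fun n => ?_
  simpa using (hypergeometricCoeff_ratio 1 ha hb n).symm

theorem tendsto_hypergeometricCoeff_ratio_atTop (d : ℕ) (ha : ∀ i < q + (d + 2), 0 < a i)
    (hb : ∀ j < q, 0 < b j) :
    Tendsto (fun n : ℕ => hypergeometricCoeff (q + (d + 2)) q a b (n + 1) /
      hypergeometricCoeff (q + (d + 2)) q a b n / ((n : ℝ) + 1)) atTop atTop := by
  have h := (tendsto_prod_add_div_add q a b).pos_mul_atTop one_pos
    ((tendsto_prod_add_natCast_atTop d fun i => a (q + i)).atTop_mul_pos one_pos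
      (tendsto_add_natCast_div (a (q + (d + 1)))))
  refine h.congr fun n => ?_
  rw [hypergeometricCoeff_ratio (d + 2) ha hb n, prod_range_succ _ (d + 1), mul_div_assoc]

theorem expGenFun_eq_zero_of_tendsto_ratio_atTop {g : ℕ → ℝ} (hg : ∀ n, 0 < g n)
    (h : Tendsto (fun n : ℕ => g (n + 1) / g n / ((n : ℝ) + 1)) atTop atTop) {x : ℝ}
    (hx : 0 < x) : expGenFun g x = 0 := by
  have hpos : ∀ n, 0 < g n / n.factorial * x ^ n := fun n =>
    mul_pos (div_pos (hg _) (by positivity)) (pow_pos hx n)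
  refine tsum_eq_zero_of_not_summable
    (not_summable_of_ratio_norm_eventually_ge one_lt_two
      (Eventually.of_forall fun n => (norm_pos_iff.2 (hpos n).ne').ne').frequently ?_)
  filter_upwards [h.eventually_ge_atTop (2 / x)] with n hn
  rw [Real.norm_of_nonneg (hpos _).le, Real.norm_of_nonneg (hpos _).le]
  have hgn := (hg n).ne'
  calc 2 * (g n / n.factorial * x ^ n) = 2 / x * (g n / n.factorial * x ^ (n + 1)) := by
        rw [pow_succ]; field_simp
    _ ≤ g (n + 1) / g n / ((n : ℝ) + 1) * (g n / n.factorial * x ^ (n + 1)) := by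
        gcongr
        exact mul_nonneg (div_pos (hg n) (by positivity)).le (by positivity)
    _ = _ := by
        rw [Nat.factorial_succ]
        push_cast
        field_simp

end Coefficients

theorem stmt_12 (p q : ℕ) (hpq : q ≤ p) (a b : ℕ → ℝ)
    (ha : ∀ i < p, 0 < a i) (hb : ∀ j < q, 0 < b j)
    (hchain : ∀ j, 1 ≤ j → j ≤ q →
      esymm p a (p - q + j) / esymm q b j ≤ esymm p a (p - q + j - 1) / esymm q b (j - 1)) :
    (ConvexOn ℝ (Set.Ioo (0 : ℝ) 1) (fun x => Real.log (pFq p q a b x)) ∧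
      ∀ x ∈ Set.Ioo (0 : ℝ) 1,
        (deriv (pFq p q a b) x) ^ 2 ≤ pFq p q a b x * deriv (deriv (pFq p q a b)) x) ∧
    (p = q →
      ConvexOn ℝ (Set.Ioi (0 : ℝ)) (fun x => Real.log (pFq p q a b x)) ∧
      ∀ x : ℝ, 0 < x →
        (deriv (pFq p q a b) x) ^ 2 ≤ pFq p q a b x * deriv (deriv (pFq p q a b)) x) := by

  rw [pFq_eq_expGenFun]
  have hg := hypergeometricCoeff_pos ha hb
  have hlog := hypergeometricCoeff_sq_le hpq ha hb hchain
  have hentire : p = q →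
      ConvexOn ℝ (Set.Ioi (0 : ℝ)) (fun x =>
        Real.log (expGenFun (hypergeometricCoeff p q a b) x)) ∧
      ∀ x : ℝ, 0 < x → deriv (expGenFun (hypergeometricCoeff p q a b)) x ^ 2 ≤
        expGenFun (hypergeometricCoeff p q a b) x *
          deriv (deriv (expGenFun (hypergeometricCoeff p q a b))) x := by
    rintro rfl
    refine logConvex_expGenFun hg hlog isOpen_Ioi (convex_Ioi 0) fun x hx => ⟨hx, x + 1, ?_, ?_⟩
    · simp
    · have hx' : 0 < x := hx
      exact summable_shift_of_tendsto_ratio hg (tendsto_hypergeometricCoeff_ratio_zero ha hb)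
        (by positivity) (by simp)
  refine ⟨?_, hentire⟩
  obtain ⟨d, rfl⟩ := Nat.exists_eq_add_of_le hpq
  match d with
  | 0 =>
    obtain ⟨hconv, hineq⟩ := hentire rfl
    exact ⟨hconv.subset (fun x hx => hx.1) (convex_Ioo 0 1), fun x hx => hineq x hx.1⟩
  | 1 =>
    refine logConvex_expGenFun hg hlog isOpen_Ioo (convex_Ioo 0 1) fun x hx => ⟨hx.1, ?_⟩
    obtain ⟨r, hxr, hr⟩ := exists_between hx.2
    exact ⟨r, hxr, summable_shift_of_tendsto_ratio hg
      (tendsto_hypergeometricCoeff_ratio_one ha hb) (hx.1.trans hxr) (by rwa [one_mul])⟩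
  | d + 2 =>
    have hzero : ∀ x ∈ Set.Ioo (0 : ℝ) 1,
        expGenFun (hypergeometricCoeff (q + (d + 2)) q a b) x = 0 := fun x hx =>
      expGenFun_eq_zero_of_tendsto_ratio_atTop hg
        (tendsto_hypergeometricCoeff_ratio_atTop d ha hb) hx.1
    refine ⟨(convexOn_const (0 : ℝ) (convex_Ioo 0 1)).congr fun x hx => ?_, fun x hx => ?_⟩
    · simp [hzero x hx]
    · have hev : expGenFun (hypergeometricCoeff (q + (d + 2)) q a b) =ᶠ[nhds x] fun _ => 0 := by
        filter_upwards [isOpen_Ioo.mem_nhds hx] with y hy using hzero y hy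
      rw [hev.deriv_eq, hzero x hx]
      simp
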